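/- In U_{r,s}(sp_4) (type C_2), define E_{12} = e_1e_2 − s²e_2e_1, F_{12} = f_2f_1 − r²f_1f_2, E_{112} = e_1E_{12} − rs·E_{12}e_1, and F_{112} = F_{12}f_1 − rs·f_1F_{12}. Then the following identities hold: [e_1, F_{12}] = −(r+s)ω_1f_2; [e_2, F_{12}] = f_1ω_2'; [E_{12}, f_1] = −(r+s)e_2ω_1'; [E_{12}, f_2] = ω_2e_1; [E_{12}, F_{12}] = (ω_1ω_2 − ω_1'ω_2')/(r − s); and [E_{112}, F_{112}] = ((r+s)²/(r² − s²))·(ω_1²ω_2 − ω_1'²ω_2'). -/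

import Mathlib

noncomputable section

/-- K = ℚ(r,s), the field of rational functions in two indeterminates r, s. -/
abbrev KK : Type := FractionRing (MvPolynomial (Fin 2) ℚ)
def qr : KK := algebraMap (MvPolynomial (Fin 2) ℚ) KK (MvPolynomial.X 0)
def qs : KK := algebraMap (MvPolynomial (Fin 2) ℚ) KK (MvPolynomial.X 1)

/-- The three rank-2 types: A₂ (sl₃), B₂ (so₅), C₂ (sp₄). -/
inductive R2T | A | B | C
deriving DecidableEq

/-- Generators e_i, f_i, ω_i^{±1}, ω_i'^{±1} (0-indexed, i : Fin 2). -/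
inductive G2
  | e (i : Fin 2) | f (i : Fin 2)
  | w (i : Fin 2) | winv (i : Fin 2) | wp (i : Fin 2) | wpinv (i : Fin 2)

/-- the toral generators ω_i^{±1}, ω_i'^{±1} -/
def G2.toral : G2 → Prop
  | .e _ => False
  | .f _ => False
  | _ => True

/-- Structure constants ⟨ω_i', ω_j⟩ (0-indexed) of `U_{ρ,σ}`:
A₂: ⟨ω₁',ω₁⟩ = ⟨ω₂',ω₂⟩ = rs⁻¹, ⟨ω₁',ω₂⟩ = r⁻¹, ⟨ω₂',ω₁⟩ = s;
B₂: ⟨ω₁',ω₁⟩ = r²s⁻², ⟨ω₁',ω₂⟩ = r⁻², ⟨ω₂',ω₁⟩ = s², ⟨ω₂',ω₂⟩ = rs⁻¹;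
C₂: ⟨ω₁',ω₁⟩ = rs⁻¹, ⟨ω₁',ω₂⟩ = r⁻², ⟨ω₂',ω₁⟩ = s², ⟨ω₂',ω₂⟩ = r²s⁻². -/
def cst2 (t : R2T) (ρ σ : KK) : Fin 2 → Fin 2 → KK :=
  match t with
  | .A => ![![ρ * σ⁻¹, ρ⁻¹], ![σ, ρ * σ⁻¹]]
  | .B => ![![ρ^2 * σ^(-2:ℤ), ρ^(-2:ℤ)], ![σ^2, ρ * σ⁻¹]]
  | .C => ![![ρ * σ⁻¹, ρ^(-2:ℤ)], ![σ^2, ρ^2 * σ^(-2:ℤ)]]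

/-- (r₁, r₂) : A₂: (r,r); B₂: (r²,r); C₂: (r,r²); similarly for s with the other argument. -/
def ri2 (t : R2T) (ρ : KK) : Fin 2 → KK :=
  match t with
  | .A => ![ρ, ρ] | .B => ![ρ^2, ρ] | .C => ![ρ, ρ^2]

/-- Cartan matrix -/
def a2 (t : R2T) : Fin 2 → Fin 2 → ℤ :=
  match t with
  | .A => ![![2, -1], ![-1, 2]]
  | .B => ![![2, -1], ![-2, 2]]
  | .C => ![![2, -2], ![-1, 2]]

abbrev F2 : Type := FreeAlgebra KK G2
abbrev X : G2 → F2 := FreeAlgebra.ι KK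

/-- The defining relations of the two-parameter quantum group `U_{ρ,σ}(g)` of rank 2. -/
inductive Rel2 (t : R2T) (ρ σ : KK) : F2 → F2 → Prop
  /- the ω's commute pairwise -/
  | comm (g g' : G2) (hg : g.toral) (hg' : g'.toral) :
      Rel2 t ρ σ (X g * X g') (X g' * X g)
  /- and are invertible -/
  | winv_r (i : Fin 2) : Rel2 t ρ σ (X (.w i) * X (.winv i)) 1
  | winv_l (i : Fin 2) : Rel2 t ρ σ (X (.winv i) * X (.w i)) 1
  | wpinv_r (i : Fin 2) : Rel2 t ρ σ (X (.wp i) * X (.wpinv i)) 1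
  | wpinv_l (i : Fin 2) : Rel2 t ρ σ (X (.wpinv i) * X (.wp i)) 1
  /- ω_j e_i ω_j⁻¹ = ⟨ω_i',ω_j⟩ e_i,  ω_j f_i ω_j⁻¹ = ⟨ω_i',ω_j⟩⁻¹ f_i -/
  | wE (i j : Fin 2) :
      Rel2 t ρ σ (X (.w j) * X (.e i) * X (.winv j)) (cst2 t ρ σ i j • X (.e i))
  | wF (i j : Fin 2) :
      Rel2 t ρ σ (X (.w j) * X (.f i) * X (.winv j)) ((cst2 t ρ σ i j)⁻¹ • X (.f i))
  /- ω_j' e_i ω_j'⁻¹ = ⟨ω_j',ω_i⟩⁻¹ e_i,  ω_j' f_i ω_j'⁻¹ = ⟨ω_j',ω_i⟩ f_i -/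
  | wpE (i j : Fin 2) :
      Rel2 t ρ σ (X (.wp j) * X (.e i) * X (.wpinv j)) ((cst2 t ρ σ j i)⁻¹ • X (.e i))
  | wpF (i j : Fin 2) :
      Rel2 t ρ σ (X (.wp j) * X (.f i) * X (.wpinv j)) (cst2 t ρ σ j i • X (.f i))
  /- [e_i, f_j] = δ_{ij} (ω_i − ω_i')/(r_i − s_i) -/
  | ef (i j : Fin 2) :
      Rel2 t ρ σ (X (.e i) * X (.f j) - X (.f j) * X (.e i))
        (if i = j then (ri2 t ρ i - ri2 t σ i)⁻¹ • (X (.w i) - X (.wp i)) else 0)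
  /- (r,s)-Serre relations, type A₂ -/
  | serreAe1 (h : t = .A) : Rel2 t ρ σ
      (X (.e 0)^2 * X (.e 1) - (ρ + σ) • (X (.e 0) * X (.e 1) * X (.e 0))
        + (ρ * σ) • (X (.e 1) * X (.e 0)^2)) 0
  | serreAe2 (h : t = .A) : Rel2 t ρ σ
      (X (.e 1)^2 * X (.e 0) - (ρ⁻¹ + σ⁻¹) • (X (.e 1) * X (.e 0) * X (.e 1))
        + (ρ * σ)⁻¹ • (X (.e 0) * X (.e 1)^2)) 0
  | serreAf1 (h : t = .A) : Rel2 t ρ σ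
      (X (.f 1) * X (.f 0)^2 - (ρ + σ) • (X (.f 0) * X (.f 1) * X (.f 0))
        + (ρ * σ) • (X (.f 0)^2 * X (.f 1))) 0
  | serreAf2 (h : t = .A) : Rel2 t ρ σ
      (X (.f 0) * X (.f 1)^2 - (ρ⁻¹ + σ⁻¹) • (X (.f 1) * X (.f 0) * X (.f 1))
        + (ρ * σ)⁻¹ • (X (.f 1)^2 * X (.f 0))) 0
  /- (r,s)-Serre relations, type B₂ -/
  | serreBe1 (h : t = .B) : Rel2 t ρ σ
      (X (.e 0)^2 * X (.e 1) - (ρ^2 + σ^2) • (X (.e 0) * X (.e 1) * X (.e 0))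
        + (ρ^2 * σ^2) • (X (.e 1) * X (.e 0)^2)) 0
  | serreBe2 (h : t = .B) : Rel2 t ρ σ
      (X (.e 1)^3 * X (.e 0)
        - (ρ^(-2:ℤ) + ρ⁻¹*σ⁻¹ + σ^(-2:ℤ)) • (X (.e 1)^2 * X (.e 0) * X (.e 1))
        + ((ρ*σ)⁻¹ * (ρ^(-2:ℤ) + ρ⁻¹*σ⁻¹ + σ^(-2:ℤ))) • (X (.e 1) * X (.e 0) * X (.e 1)^2)
        - (ρ*σ)^(-3:ℤ) • (X (.e 0) * X (.e 1)^3)) 0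
  | serreBf1 (h : t = .B) : Rel2 t ρ σ
      (X (.f 1) * X (.f 0)^2 - (ρ^2 + σ^2) • (X (.f 0) * X (.f 1) * X (.f 0))
        + (ρ^2 * σ^2) • (X (.f 0)^2 * X (.f 1))) 0
  | serreBf2 (h : t = .B) : Rel2 t ρ σ
      (X (.f 0) * X (.f 1)^3
        - (ρ^(-2:ℤ) + ρ⁻¹*σ⁻¹ + σ^(-2:ℤ)) • (X (.f 1) * X (.f 0) * X (.f 1)^2)
        + ((ρ*σ)⁻¹ * (ρ^(-2:ℤ) + ρ⁻¹*σ⁻¹ + σ^(-2:ℤ))) • (X (.f 1)^2 * X (.f 0) * X (.f 1))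
        - (ρ*σ)^(-3:ℤ) • (X (.f 1)^3 * X (.f 0))) 0
  /- (r,s)-Serre relations, type C₂ -/
  | serreCe1 (h : t = .C) : Rel2 t ρ σ
      (X (.e 0)^3 * X (.e 1) - (ρ^2 + ρ*σ + σ^2) • (X (.e 0)^2 * X (.e 1) * X (.e 0))
        + (ρ*σ*(ρ^2 + ρ*σ + σ^2)) • (X (.e 0) * X (.e 1) * X (.e 0)^2)
        - (ρ*σ)^3 • (X (.e 1) * X (.e 0)^3)) 0
  | serreCe2 (h : t = .C) : Rel2 t ρ σ
      (X (.e 1)^2 * X (.e 0) - (ρ^(-2:ℤ) + σ^(-2:ℤ)) • (X (.e 1) * X (.e 0) * X (.e 1))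
        + (ρ*σ)^(-2:ℤ) • (X (.e 0) * X (.e 1)^2)) 0
  | serreCf1 (h : t = .C) : Rel2 t ρ σ
      (X (.f 1) * X (.f 0)^3 - (ρ^2 + ρ*σ + σ^2) • (X (.f 0) * X (.f 1) * X (.f 0)^2)
        + (ρ*σ*(ρ^2 + ρ*σ + σ^2)) • (X (.f 0)^2 * X (.f 1) * X (.f 0))
        - (ρ*σ)^3 • (X (.f 0)^3 * X (.f 1))) 0
  | serreCf2 (h : t = .C) : Rel2 t ρ σ
      (X (.f 0) * X (.f 1)^2 - (ρ^(-2:ℤ) + σ^(-2:ℤ)) • (X (.f 1) * X (.f 0) * X (.f 1))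
        + (ρ*σ)^(-2:ℤ) • (X (.f 1)^2 * X (.f 0))) 0

/-- The rank-2 two-parameter quantum group `U_{ρ,σ}(g)`. -/
abbrev U2 (t : R2T) (ρ σ : KK) : Type := RingQuot (Rel2 t ρ σ)

/-- images of the generators in `U_{ρ,σ}(g)` -/
def gen2 (t : R2T) (ρ σ : KK) (g : G2) : U2 t ρ σ :=
  RingQuot.mkAlgHom KK (Rel2 t ρ σ) (X g)

/-- ⟨k⟩! for parameters (a,b) in place of (r_i,s_i):
⟨l⟩ = (b^{-l} − a^{-l})/(b⁻¹ − a⁻¹),  ⟨k⟩! = ⟨1⟩⟨2⟩⋯⟨k⟩. -/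
def angf (a b : KK) (k : ℕ) : KK :=
  ∏ l ∈ Finset.range k, ((b ^ (-(l:ℤ)-1) - a ^ (-(l:ℤ)-1)) / (b⁻¹ - a⁻¹))

/-- d_i, where r_i = r^{d_i} -/
def d2 (t : R2T) : Fin 2 → ℤ :=
  match t with | .A => ![1,1] | .B => ![2,1] | .C => ![1,2]

/-- m = −a_{ij} (for i ≠ j) -/
def m2 (t : R2T) (i j : Fin 2) : ℕ := (-(a2 t i j)).toNat

/-- divided power e_i^{(k)} = e_i^k/⟨k⟩_i! of the generator e_i of `U_{ρ',σ'}(g)`,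
with ⟨k⟩_i! formed from the (source) parameters (ρ,σ). -/
def Edp (t : R2T) (ρ σ ρ' σ' : KK) (i : Fin 2) (k : ℕ) : U2 t ρ' σ' :=
  (angf (ri2 t ρ i) (ri2 t σ i) k)⁻¹ • (gen2 t ρ' σ' (.e i))^k

def Fdp (t : R2T) (ρ σ ρ' σ' : KK) (i : Fin 2) (k : ℕ) : U2 t ρ' σ' :=
  (angf (ri2 t ρ i) (ri2 t σ i) k)⁻¹ • (gen2 t ρ' σ' (.f i))^k

/-- The coefficient (−1)^ν (ρσ)^{ν(−a_{ij}−ν)/2} ⟨ω_j',ω_i⟩^{∓ν} ⟨ω_i',ω_i⟩^{±ν(1+a_{ij})/2}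
of Definition 3.2 (the second sign option in type B), with the two half-integer powers
multiplied out into integer powers of ρ and σ (using ⟨ω_i',ω_i⟩ = ρ^{d_i}σ^{−d_i}). -/
def coefE (t : R2T) (ρ σ : KK) (i j : Fin 2) (ν : ℕ) : KK :=
  let m : ℤ := m2 t i j
  let p : ℤ := ν * (m - ν)
  let q : ℤ := ν * (1 - m)
  let d : ℤ := d2 t i
  match t with
  | .B => (-1:KK)^ν * ρ^((p - d*q)/2) * σ^((p + d*q)/2) * (cst2 t ρ σ j i)^(ν:ℤ)
  | _ => (-1:KK)^ν * ρ^((p + d*q)/2) * σ^((p - d*q)/2) * (cst2 t ρ σ j i)^(-(ν:ℤ))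

/-- likewise (−1)^ν (ρσ)^{ν(−a_{ij}−ν)/2} ⟨ω_i',ω_j⟩^{±ν} ⟨ω_i',ω_i⟩^{∓ν(1+a_{ij})/2} -/
def coefF (t : R2T) (ρ σ : KK) (i j : Fin 2) (ν : ℕ) : KK :=
  let m : ℤ := m2 t i j
  let p : ℤ := ν * (m - ν)
  let q : ℤ := ν * (1 - m)
  let d : ℤ := d2 t i
  match t with
  | .B => (-1:KK)^ν * ρ^((p + d*q)/2) * σ^((p - d*q)/2) * (cst2 t ρ σ i j)^(-(ν:ℤ))
  | _ => (-1:KK)^ν * ρ^((p - d*q)/2) * σ^((p + d*q)/2) * (cst2 t ρ σ i j)^(ν:ℤ)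

/-- T_i(e_j) (Definition 3.2), an element of the target algebra `U_{ρ',σ'}(g)`,
with coefficients formed from the source parameters (ρ,σ). -/
def TE (t : R2T) (ρ σ ρ' σ' : KK) (i j : Fin 2) : U2 t ρ' σ' :=
  if i = j then -(gen2 t ρ' σ' (.wpinv i) * gen2 t ρ' σ' (.f i))
  else if t = .B then
    ∑ ν ∈ Finset.range (m2 t i j + 1),
      coefE t ρ σ i j ν •
        (Edp t ρ σ ρ' σ' i (m2 t i j - ν) * gen2 t ρ' σ' (.e j) * Edp t ρ σ ρ' σ' i ν)
  else
    ∑ ν ∈ Finset.range (m2 t i j + 1),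
      coefE t ρ σ i j ν •
        (Edp t ρ σ ρ' σ' i ν * gen2 t ρ' σ' (.e j) * Edp t ρ σ ρ' σ' i (m2 t i j - ν))

/-- T_i(f_j) (Definition 3.2). -/
def TF (t : R2T) (ρ σ ρ' σ' : KK) (i j : Fin 2) : U2 t ρ' σ' :=
  if i = j then -((ri2 t ρ i * ri2 t σ i) • (gen2 t ρ' σ' (.e i) * gen2 t ρ' σ' (.winv i)))
  else if t = .B then
    ((ri2 t ρ j * ri2 t σ j)^(if j < i then 2 else 1)) •
      ∑ ν ∈ Finset.range (m2 t i j + 1),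
        coefF t ρ σ i j ν •
          (Fdp t ρ σ ρ' σ' i ν * gen2 t ρ' σ' (.f j) * Fdp t ρ σ ρ' σ' i (m2 t i j - ν))
  else
    ((ri2 t ρ j * ri2 t σ j)^(if i < j then 2 else 1)) •
      ∑ ν ∈ Finset.range (m2 t i j + 1),
        coefF t ρ σ i j ν •
          (Fdp t ρ σ ρ' σ' i (m2 t i j - ν) * gen2 t ρ' σ' (.f j) * Fdp t ρ σ ρ' σ' i ν)

/-- ω_i^k for k : ℤ -/
def wzW (t : R2T) (ρ' σ' : KK) (i : Fin 2) (k : ℤ) : U2 t ρ' σ' :=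
  if 0 ≤ k then (gen2 t ρ' σ' (.w i))^(k.toNat) else (gen2 t ρ' σ' (.winv i))^((-k).toNat)

/-- ω_i'^k for k : ℤ -/
def wzWp (t : R2T) (ρ' σ' : KK) (i : Fin 2) (k : ℤ) : U2 t ρ' σ' :=
  if 0 ≤ k then (gen2 t ρ' σ' (.wp i))^(k.toNat) else (gen2 t ρ' σ' (.wpinv i))^((-k).toNat)

/-- T_i(ω_j) = ω_j ω_i^{−a_{ij}} -/
def TW (t : R2T) (ρ' σ' : KK) (i j : Fin 2) : U2 t ρ' σ' :=
  gen2 t ρ' σ' (.w j) * wzW t ρ' σ' i (-(a2 t i j))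

/-- T_i(ω_j)⁻¹ = ω_i^{a_{ij}} ω_j⁻¹ -/
def TWinv (t : R2T) (ρ' σ' : KK) (i j : Fin 2) : U2 t ρ' σ' :=
  wzW t ρ' σ' i (a2 t i j) * gen2 t ρ' σ' (.winv j)

/-- T_i(ω_j') = ω_j' ω_i'^{−a_{ij}} -/
def TWp (t : R2T) (ρ' σ' : KK) (i j : Fin 2) : U2 t ρ' σ' :=
  gen2 t ρ' σ' (.wp j) * wzWp t ρ' σ' i (-(a2 t i j))

/-- T_i(ω_j')⁻¹ = ω_i'^{a_{ij}} ω_j'⁻¹ -/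
def TWpinv (t : R2T) (ρ' σ' : KK) (i j : Fin 2) : U2 t ρ' σ' :=
  wzWp t ρ' σ' i (a2 t i j) * gen2 t ρ' σ' (.wpinv j)



/-!
STATEMENT 19.  In U_{r,s}(sp₄) (type C₂), with (0-indexed generators)
E₁₂ = e₁e₂ − s²e₂e₁, F₁₂ = f₂f₁ − r²f₁f₂, E₁₁₂ = e₁E₁₂ − rs·E₁₂e₁,
F₁₁₂ = F₁₂f₁ − rs·f₁F₁₂, the stated commutator identities hold.
-/

namespace Stmt19

abbrev UC : Type := U2 .C qr qs
def e₁ : UC := gen2 .C qr qs (.e 0)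
def e₂ : UC := gen2 .C qr qs (.e 1)
def f₁ : UC := gen2 .C qr qs (.f 0)
def f₂ : UC := gen2 .C qr qs (.f 1)
def ω₁ : UC := gen2 .C qr qs (.w 0)
def ω₂ : UC := gen2 .C qr qs (.w 1)
def ω₁' : UC := gen2 .C qr qs (.wp 0)
def ω₂' : UC := gen2 .C qr qs (.wp 1)

def E₁₂ : UC := e₁ * e₂ - qs^2 • (e₂ * e₁)
def F₁₂ : UC := f₂ * f₁ - qr^2 • (f₁ * f₂)
def E₁₁₂ : UC := e₁ * E₁₂ - (qr*qs) • (E₁₂ * e₁)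
def F₁₁₂ : UC := F₁₂ * f₁ - (qr*qs) • (f₁ * F₁₂)

section SkewCommutators

variable {K A : Type*} [CommRing K] [Ring A] [Algebra K A]

/-- The skew commutator `xy - c yx`. -/
def skewBracket (c : K) (x y : A) : A := x * y - c • (y * x)

lemma commutator_skew_right {x f g u v : A} (c : K) (hf : x * f - f * x = u)
    (hg : x * g - g * x = v) :
    x * skewBracket c f g - skewBracket c f g * x
      = u * g + f * v - c • (v * f + g * u) := by
  subst hf hg
  simp only [skewBracket, mul_sub, sub_mul, mul_smul_comm, smul_mul_assoc, mul_assoc]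
  module

lemma commutator_skew_left {x f g u v : A} (c : K) (hf : f * x - x * f = u)
    (hg : g * x - x * g = v) :
    skewBracket c f g * x - x * skewBracket c f g
      = u * g + f * v - c • (v * f + g * u) := by
  subst hf hg
  simp only [skewBracket, mul_sub, sub_mul, mul_smul_comm, smul_mul_assoc, mul_assoc]
  module

lemma mul_mul_of_skew_comm {w x : A} {a : K} (h : w * x = a • (x * w)) (y : A) :
    w * (x * y) = a • (x * (w * y)) := by
  rw [← mul_assoc, h, smul_mul_assoc, mul_assoc]

lemma skew_comm_mul {w x y : A} {a b : K} (hx : w * x = a • (x * w))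
    (hy : w * y = b • (y * w)) : w * (x * y) = (a * b) • ((x * y) * w) := by
  rw [mul_mul_of_skew_comm hx, hy, mul_smul_comm, smul_smul, mul_assoc]

lemma mul_skew_comm {v w x : A} {a b : K} (hv : v * x = a • (x * v))
    (hw : w * x = b • (x * w)) : (v * w) * x = (a * b) • (x * (v * w)) := by
  rw [mul_assoc, hw, mul_smul_comm, mul_mul_of_skew_comm hv, smul_smul, mul_comm b]

lemma skew_comm_skew_bracket {w x y : A} {a b : K} (c : K) (hx : w * x = a • (x * w))
    (hy : w * y = b • (y * w)) :
    w * skewBracket c x y = (a * b) • (skewBracket c x y * w) := by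
  rw [skewBracket, mul_sub, mul_smul_comm, skew_comm_mul hx hy, skew_comm_mul hy hx,
    sub_mul, smul_mul_assoc, mul_comm b]
  module

lemma commutator_skew_chain {x f g e e' w w' a b : A} {c k l : K}
    (hf : x * f - f * x = k • (w * e)) (hg : x * g - g * x = -(l • (e' * w')))
    (hw : w * g = c • (g * w)) (hw' : f * w' = c • (w' * f))
    (ha : e * g - g * e = a) (hb : e' * f - f * e' = b) :
    x * skewBracket c f g - skewBracket c f g * x = k • (w * a) + l • (b * w') := by
  have h₁ : w * (g * e) = c • (g * (w * e)) := mul_mul_of_skew_comm hw e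
  have h₂ : e' * (f * w') = c • (e' * (w' * f)) := by rw [hw', mul_smul_comm]
  rw [commutator_skew_right c hf hg]
  subst ha hb
  simp only [mul_sub, sub_mul, mul_smul_comm, smul_mul_assoc, mul_assoc, mul_neg, neg_mul, h₁, h₂]
  module

lemma skew_comm_of_conj {w w' x : A} {a : K} (hw : w' * w = 1) (h : w * x * w' = a • x) :
    w * x = a • (x * w) := by
  rw [← smul_mul_assoc, ← h, mul_assoc, hw, mul_one]

end SkewCommutators

section TypeC

variable {K A : Type*} [Field K] [Ring A] [Algebra K A]

/-- The relations of `U_{r,s}(sp₄)` without inverses of the toral elements and without the Serre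
relations, as far as commutators of root vectors depend on them. -/
structure TypeCRelations (r s : K) (e₁ e₂ f₁ f₂ ω₁ ω₂ ω₁' ω₂' : A) : Prop where
  ω₁_mul_e₁ : ω₁ * e₁ = (r * s⁻¹) • (e₁ * ω₁)
  ω₁_mul_f₁ : ω₁ * f₁ = (s * r⁻¹) • (f₁ * ω₁)
  ω₁'_mul_e₁ : ω₁' * e₁ = (s * r⁻¹) • (e₁ * ω₁')
  ω₁'_mul_f₁ : ω₁' * f₁ = (r * s⁻¹) • (f₁ * ω₁')
  ω₁_mul_e₂ : ω₁ * e₂ = s ^ 2 • (e₂ * ω₁)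
  ω₁_mul_f₂ : ω₁ * f₂ = (s ^ 2)⁻¹ • (f₂ * ω₁)
  ω₁'_mul_e₂ : ω₁' * e₂ = r ^ 2 • (e₂ * ω₁')
  ω₁'_mul_f₂ : ω₁' * f₂ = (r ^ 2)⁻¹ • (f₂ * ω₁')
  ω₂_mul_e₁ : ω₂ * e₁ = (r ^ 2)⁻¹ • (e₁ * ω₂)
  ω₂_mul_f₁ : ω₂ * f₁ = r ^ 2 • (f₁ * ω₂)
  ω₂'_mul_e₁ : ω₂' * e₁ = (s ^ 2)⁻¹ • (e₁ * ω₂')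
  ω₂'_mul_f₁ : ω₂' * f₁ = s ^ 2 • (f₁ * ω₂')
  e₁_f₁ : e₁ * f₁ - f₁ * e₁ = (r - s)⁻¹ • (ω₁ - ω₁')
  e₁_f₂ : e₁ * f₂ - f₂ * e₁ = 0
  e₂_f₂ : e₂ * f₂ - f₂ * e₂ = (r ^ 2 - s ^ 2)⁻¹ • (ω₂ - ω₂')
  e₂_f₁ : e₂ * f₁ - f₁ * e₂ = 0
  ω₂_ω₁ : ω₂ * ω₁ = ω₁ * ω₂
  ω₂_ω₁' : ω₂ * ω₁' = ω₁' * ω₂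
  ω₂'_ω₁' : ω₂' * ω₁' = ω₁' * ω₂'

namespace TypeCRelations

variable {r s : K} {e₁ e₂ f₁ f₂ ω₁ ω₂ ω₁' ω₂' : A}

lemma e₁_F₁₂ (h : TypeCRelations r s e₁ e₂ f₁ f₂ ω₁ ω₂ ω₁' ω₂')
    (hr : r ≠ 0) (hs : s ≠ 0) (hd : r - s ≠ 0) :
    e₁ * skewBracket (r ^ 2) f₂ f₁ - skewBracket (r ^ 2) f₂ f₁ * e₁
      = -((r + s) • (ω₁ * f₂)) := by
  rw [commutator_skew_right _ h.e₁_f₂ h.e₁_f₁]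
  simp only [mul_sub, sub_mul, mul_smul_comm, smul_mul_assoc, mul_zero, zero_mul,
    h.ω₁_mul_f₂, h.ω₁'_mul_f₂]
  match_scalars <;> field_simp <;> ring

lemma e₂_F₁₂ (h : TypeCRelations r s e₁ e₂ f₁ f₂ ω₁ ω₂ ω₁' ω₂')
    (hd : r - s ≠ 0) (ha : r + s ≠ 0) :
    e₂ * skewBracket (r ^ 2) f₂ f₁ - skewBracket (r ^ 2) f₂ f₁ * e₂ = f₁ * ω₂' := by
  have hq : r ^ 2 - s ^ 2 ≠ 0 := by rw [sq_sub_sq]; exact mul_ne_zero ha hd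
  rw [commutator_skew_right _ h.e₂_f₂ h.e₂_f₁]
  simp only [mul_sub, sub_mul, mul_smul_comm, smul_mul_assoc, mul_zero, zero_mul,
    h.ω₂_mul_f₁, h.ω₂'_mul_f₁]
  match_scalars <;> field_simp <;> ring

lemma E₁₂_f₁ (h : TypeCRelations r s e₁ e₂ f₁ f₂ ω₁ ω₂ ω₁' ω₂')
    (hd : r - s ≠ 0) :
    skewBracket (s ^ 2) e₁ e₂ * f₁ - f₁ * skewBracket (s ^ 2) e₁ e₂
      = -((r + s) • (e₂ * ω₁')) := by
  rw [commutator_skew_left _ h.e₁_f₁ h.e₂_f₁]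
  simp only [mul_sub, sub_mul, mul_smul_comm, smul_mul_assoc, mul_zero, zero_mul,
    h.ω₁_mul_e₂, h.ω₁'_mul_e₂]
  match_scalars <;> field_simp <;> ring

lemma E₁₂_f₂ (h : TypeCRelations r s e₁ e₂ f₁ f₂ ω₁ ω₂ ω₁' ω₂')
    (hr : r ≠ 0) (hs : s ≠ 0) (hd : r - s ≠ 0) (ha : r + s ≠ 0) :
    skewBracket (s ^ 2) e₁ e₂ * f₂ - f₂ * skewBracket (s ^ 2) e₁ e₂ = ω₂ * e₁ := by
  have hq : r ^ 2 - s ^ 2 ≠ 0 := by rw [sq_sub_sq]; exact mul_ne_zero ha hd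
  rw [commutator_skew_left _ h.e₁_f₂ h.e₂_f₂]
  simp only [mul_sub, sub_mul, mul_smul_comm, smul_mul_assoc, mul_zero, zero_mul,
    h.ω₂_mul_e₁, h.ω₂'_mul_e₁]
  match_scalars <;> field_simp
  ring

lemma ω₁_mul_E₁₂ (h : TypeCRelations r s e₁ e₂ f₁ f₂ ω₁ ω₂ ω₁' ω₂')
    (hs : s ≠ 0) :
    ω₁ * skewBracket (s ^ 2) e₁ e₂ = (r * s) • (skewBracket (s ^ 2) e₁ e₂ * ω₁) := by
  rw [skew_comm_skew_bracket _ h.ω₁_mul_e₁ h.ω₁_mul_e₂]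
  congr 1
  field_simp

lemma ω₁'_mul_E₁₂ (h : TypeCRelations r s e₁ e₂ f₁ f₂ ω₁ ω₂ ω₁' ω₂')
    (hr : r ≠ 0) :
    ω₁' * skewBracket (s ^ 2) e₁ e₂ = (r * s) • (skewBracket (s ^ 2) e₁ e₂ * ω₁') := by
  rw [skew_comm_skew_bracket _ h.ω₁'_mul_e₁ h.ω₁'_mul_e₂]
  congr 1
  field_simp

lemma ω₁'_mul_F₁₂ (h : TypeCRelations r s e₁ e₂ f₁ f₂ ω₁ ω₂ ω₁' ω₂')
    (hr : r ≠ 0) (hs : s ≠ 0) :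
    ω₁' * skewBracket (r ^ 2) f₂ f₁ = (r * s)⁻¹ • (skewBracket (r ^ 2) f₂ f₁ * ω₁') := by
  rw [skew_comm_skew_bracket _ h.ω₁'_mul_f₂ h.ω₁'_mul_f₁]
  congr 1
  field_simp

lemma ω₁ω₂_mul_e₁ (h : TypeCRelations r s e₁ e₂ f₁ f₂ ω₁ ω₂ ω₁' ω₂')
    (hr : r ≠ 0) (hs : s ≠ 0) :
    (ω₁ * ω₂) * e₁ = (r * s)⁻¹ • (e₁ * (ω₁ * ω₂)) := by
  rw [mul_skew_comm h.ω₁_mul_e₁ h.ω₂_mul_e₁]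
  congr 1
  field_simp

lemma ω₁'ω₂'_mul_e₁ (h : TypeCRelations r s e₁ e₂ f₁ f₂ ω₁ ω₂ ω₁' ω₂')
    (hr : r ≠ 0) (hs : s ≠ 0) :
    (ω₁' * ω₂') * e₁ = (r * s)⁻¹ • (e₁ * (ω₁' * ω₂')) := by
  rw [mul_skew_comm h.ω₁'_mul_e₁ h.ω₂'_mul_e₁]
  congr 1
  field_simp

lemma ω₁ω₂_mul_f₁ (h : TypeCRelations r s e₁ e₂ f₁ f₂ ω₁ ω₂ ω₁' ω₂')
    (hr : r ≠ 0) :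
    (ω₁ * ω₂) * f₁ = (r * s) • (f₁ * (ω₁ * ω₂)) := by
  rw [mul_skew_comm h.ω₁_mul_f₁ h.ω₂_mul_f₁]
  congr 1
  field_simp

lemma E₁₂_F₁₂ (h : TypeCRelations r s e₁ e₂ f₁ f₂ ω₁ ω₂ ω₁' ω₂')
    (hr : r ≠ 0) (hs : s ≠ 0) (hd : r - s ≠ 0) (ha : r + s ≠ 0) :
    skewBracket (s ^ 2) e₁ e₂ * skewBracket (r ^ 2) f₂ f₁
      - skewBracket (r ^ 2) f₂ f₁ * skewBracket (s ^ 2) e₁ e₂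
      = (r - s)⁻¹ • (ω₁ * ω₂ - ω₁' * ω₂') := by
  have hq : r ^ 2 - s ^ 2 ≠ 0 := by rw [sq_sub_sq]; exact mul_ne_zero ha hd
  have hw : f₂ * ω₁' = r ^ 2 • (ω₁' * f₂) := by
    rw [h.ω₁'_mul_f₂, smul_smul, mul_inv_cancel₀ (pow_ne_zero 2 hr), one_smul]
  have hf : skewBracket (s ^ 2) e₁ e₂ * f₂ - f₂ * skewBracket (s ^ 2) e₁ e₂
      = (1 : K) • (ω₂ * e₁) := by
    rw [one_smul, h.E₁₂_f₂ hr hs hd ha]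
  rw [commutator_skew_chain hf (h.E₁₂_f₁ hd) h.ω₂_mul_f₁ hw h.e₁_f₁ h.e₂_f₂]
  simp only [mul_sub, sub_mul, mul_smul_comm, smul_mul_assoc, h.ω₂_ω₁, h.ω₂_ω₁', h.ω₂'_ω₁']
  match_scalars <;> field_simp <;> ring

lemma E₁₁₂_f₁ (h : TypeCRelations r s e₁ e₂ f₁ f₂ ω₁ ω₂ ω₁' ω₂')
    (hr : r ≠ 0) (hs : s ≠ 0) (hd : r - s ≠ 0) :
    skewBracket (r * s) e₁ (skewBracket (s ^ 2) e₁ e₂) * f₁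
      - f₁ * skewBracket (r * s) e₁ (skewBracket (s ^ 2) e₁ e₂)
      = -((r + s) • (skewBracket (s ^ 2) e₁ e₂ * ω₁')) := by
  rw [commutator_skew_left _ h.e₁_f₁ (h.E₁₂_f₁ hd)]
  simp only [mul_sub, sub_mul, mul_smul_comm, smul_mul_assoc, mul_neg, neg_mul,
    mul_assoc, h.ω₁_mul_E₁₂ hs, h.ω₁'_mul_E₁₂ hr, h.ω₁'_mul_e₁]
  simp only [skewBracket, sub_mul, smul_mul_assoc, mul_assoc]
  match_scalars <;> field_simp <;> ring

lemma E₁₁₂_F₁₂ (h : TypeCRelations r s e₁ e₂ f₁ f₂ ω₁ ω₂ ω₁' ω₂')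
    (hr : r ≠ 0) (hs : s ≠ 0) (hd : r - s ≠ 0) (ha : r + s ≠ 0) :
    skewBracket (r * s) e₁ (skewBracket (s ^ 2) e₁ e₂) * skewBracket (r ^ 2) f₂ f₁
      - skewBracket (r ^ 2) f₂ f₁ * skewBracket (r * s) e₁ (skewBracket (s ^ 2) e₁ e₂)
      = (r + s) • ((ω₁ * ω₂) * e₁) := by
  have hE : skewBracket (s ^ 2) e₁ e₂ * ω₁ = (r * s)⁻¹ • (ω₁ * skewBracket (s ^ 2) e₁ e₂) := by
    rw [h.ω₁_mul_E₁₂ hs, smul_smul, inv_mul_cancel₀ (mul_ne_zero hr hs), one_smul]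
  rw [commutator_skew_left _ (h.e₁_F₁₂ hr hs hd) (h.E₁₂_F₁₂ hr hs hd ha), mul_assoc ω₁ ω₂ e₁,
    ← h.E₁₂_f₂ hr hs hd ha]
  simp only [sub_mul, mul_sub, mul_smul_comm, smul_mul_assoc, mul_neg, neg_mul,
    h.ω₁ω₂_mul_e₁ hr hs, h.ω₁'ω₂'_mul_e₁ hr hs, ← mul_assoc, hE]
  match_scalars <;> field_simp <;> ring

lemma E₁₁₂_F₁₁₂ (h : TypeCRelations r s e₁ e₂ f₁ f₂ ω₁ ω₂ ω₁' ω₂')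
    (hr : r ≠ 0) (hs : s ≠ 0) (hd : r - s ≠ 0) (ha : r + s ≠ 0) :
    skewBracket (r * s) e₁ (skewBracket (s ^ 2) e₁ e₂) *
        skewBracket (r * s) (skewBracket (r ^ 2) f₂ f₁) f₁
      - skewBracket (r * s) (skewBracket (r ^ 2) f₂ f₁) f₁ *
        skewBracket (r * s) e₁ (skewBracket (s ^ 2) e₁ e₂)
      = ((r + s) ^ 2 / (r ^ 2 - s ^ 2)) • (ω₁ ^ 2 * ω₂ - ω₁' ^ 2 * ω₂') := by
  have hq : r ^ 2 - s ^ 2 ≠ 0 := by rw [sq_sub_sq]; exact mul_ne_zero ha hd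
  have hw : skewBracket (r ^ 2) f₂ f₁ * ω₁' = (r * s) • (ω₁' * skewBracket (r ^ 2) f₂ f₁) := by
    rw [h.ω₁'_mul_F₁₂ hr hs, smul_smul, mul_inv_cancel₀ (mul_ne_zero hr hs), one_smul]
  rw [commutator_skew_chain (h.E₁₁₂_F₁₂ hr hs hd ha) (h.E₁₁₂_f₁ hr hs hd) (h.ω₁ω₂_mul_f₁ hr) hw
    h.e₁_f₁ (h.E₁₂_F₁₂ hr hs hd ha)]
  simp only [mul_sub, sub_mul, mul_smul_comm, smul_mul_assoc, mul_assoc, pow_two ω₁, pow_two ω₁',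
    h.ω₂_ω₁, h.ω₂_ω₁', h.ω₂'_ω₁']
  match_scalars <;> field_simp <;> ring

end TypeCRelations

end TypeC

lemma qr_ne_zero : qr ≠ 0 := by
  simp [qr, MvPolynomial.X_ne_zero]

lemma qs_ne_zero : qs ≠ 0 := by
  simp [qs, MvPolynomial.X_ne_zero]

lemma qr_sub_qs_ne_zero : qr - qs ≠ 0 := by
  rw [sub_ne_zero]
  intro h
  have := MvPolynomial.X_injective (IsFractionRing.injective (MvPolynomial (Fin 2) ℚ) KK h)
  simp at this

lemma qr_add_qs_ne_zero : qr + qs ≠ 0 := by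
  rw [qr, qs, ← map_add, map_ne_zero_iff _ (IsFractionRing.injective (MvPolynomial (Fin 2) ℚ) KK)]
  intro h
  have := congrArg (MvPolynomial.eval ![1, 0]) h
  simp at this

section Relations

variable (t : R2T) (ρ σ : KK)

lemma gen2_toral_comm {g g' : G2} (hg : g.toral) (hg' : g'.toral) :
    gen2 t ρ σ g * gen2 t ρ σ g' = gen2 t ρ σ g' * gen2 t ρ σ g := by
  simpa [gen2] using RingQuot.mkAlgHom_rel KK (Rel2.comm (t := t) (ρ := ρ) (σ := σ) g g' hg hg')

lemma gen2_w_e (i j : Fin 2) : gen2 t ρ σ (.w j) * gen2 t ρ σ (.e i)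
    = cst2 t ρ σ i j • (gen2 t ρ σ (.e i) * gen2 t ρ σ (.w j)) := by
  refine skew_comm_of_conj (w' := gen2 t ρ σ (.winv j)) ?_ ?_
  · simpa [gen2] using RingQuot.mkAlgHom_rel KK (Rel2.winv_l (t := t) (ρ := ρ) (σ := σ) j)
  · simpa [gen2] using RingQuot.mkAlgHom_rel KK (Rel2.wE (t := t) (ρ := ρ) (σ := σ) i j)

lemma gen2_w_f (i j : Fin 2) : gen2 t ρ σ (.w j) * gen2 t ρ σ (.f i)
    = (cst2 t ρ σ i j)⁻¹ • (gen2 t ρ σ (.f i) * gen2 t ρ σ (.w j)) := by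
  refine skew_comm_of_conj (w' := gen2 t ρ σ (.winv j)) ?_ ?_
  · simpa [gen2] using RingQuot.mkAlgHom_rel KK (Rel2.winv_l (t := t) (ρ := ρ) (σ := σ) j)
  · simpa [gen2] using RingQuot.mkAlgHom_rel KK (Rel2.wF (t := t) (ρ := ρ) (σ := σ) i j)

lemma gen2_wp_e (i j : Fin 2) : gen2 t ρ σ (.wp j) * gen2 t ρ σ (.e i)
    = (cst2 t ρ σ j i)⁻¹ • (gen2 t ρ σ (.e i) * gen2 t ρ σ (.wp j)) := by
  refine skew_comm_of_conj (w' := gen2 t ρ σ (.wpinv j)) ?_ ?_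
  · simpa [gen2] using RingQuot.mkAlgHom_rel KK (Rel2.wpinv_l (t := t) (ρ := ρ) (σ := σ) j)
  · simpa [gen2] using RingQuot.mkAlgHom_rel KK (Rel2.wpE (t := t) (ρ := ρ) (σ := σ) i j)

lemma gen2_wp_f (i j : Fin 2) : gen2 t ρ σ (.wp j) * gen2 t ρ σ (.f i)
    = cst2 t ρ σ j i • (gen2 t ρ σ (.f i) * gen2 t ρ σ (.wp j)) := by
  refine skew_comm_of_conj (w' := gen2 t ρ σ (.wpinv j)) ?_ ?_
  · simpa [gen2] using RingQuot.mkAlgHom_rel KK (Rel2.wpinv_l (t := t) (ρ := ρ) (σ := σ) j)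
  · simpa [gen2] using RingQuot.mkAlgHom_rel KK (Rel2.wpF (t := t) (ρ := ρ) (σ := σ) i j)

lemma gen2_e_f_same (i : Fin 2) :
    gen2 t ρ σ (.e i) * gen2 t ρ σ (.f i) - gen2 t ρ σ (.f i) * gen2 t ρ σ (.e i)
      = (ri2 t ρ i - ri2 t σ i)⁻¹ • (gen2 t ρ σ (.w i) - gen2 t ρ σ (.wp i)) := by
  simpa [gen2] using RingQuot.mkAlgHom_rel KK (Rel2.ef (t := t) (ρ := ρ) (σ := σ) i i)

lemma gen2_e_f_ne {i j : Fin 2} (h : i ≠ j) :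
    gen2 t ρ σ (.e i) * gen2 t ρ σ (.f j) - gen2 t ρ σ (.f j) * gen2 t ρ σ (.e i) = 0 := by
  simpa [gen2, h] using RingQuot.mkAlgHom_rel KK (Rel2.ef (t := t) (ρ := ρ) (σ := σ) i j)

end Relations

lemma typeCRelations_UC : TypeCRelations qr qs e₁ e₂ f₁ f₂ ω₁ ω₂ ω₁' ω₂' where
  ω₁_mul_e₁ := by
    have h := gen2_w_e .C qr qs 0 0
    simp [cst2] at h
    exact h
  ω₁_mul_f₁ := by
    have h := gen2_w_f .C qr qs 0 0
    simp [cst2] at h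
    exact h
  ω₁'_mul_e₁ := by
    have h := gen2_wp_e .C qr qs 0 0
    simp [cst2] at h
    exact h
  ω₁'_mul_f₁ := by
    have h := gen2_wp_f .C qr qs 0 0
    simp [cst2] at h
    exact h
  ω₁_mul_e₂ := by
    have h := gen2_w_e .C qr qs 1 0
    simp [cst2] at h
    exact h
  ω₁_mul_f₂ := by
    have h := gen2_w_f .C qr qs 1 0
    simp [cst2] at h
    exact h
  ω₁'_mul_e₂ := by
    have h := gen2_wp_e .C qr qs 1 0
    simp [cst2] at h
    exact h
  ω₁'_mul_f₂ := by
    have h := gen2_wp_f .C qr qs 1 0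
    simp [cst2] at h
    exact h
  ω₂_mul_e₁ := by
    have h := gen2_w_e .C qr qs 0 1
    simp [cst2] at h
    exact h
  ω₂_mul_f₁ := by
    have h := gen2_w_f .C qr qs 0 1
    simp [cst2] at h
    exact h
  ω₂'_mul_e₁ := by
    have h := gen2_wp_e .C qr qs 0 1
    simp [cst2] at h
    exact h
  ω₂'_mul_f₁ := by
    have h := gen2_wp_f .C qr qs 0 1
    simp [cst2] at h
    exact h
  e₁_f₁ := by
    have h := gen2_e_f_same .C qr qs 0
    simp [ri2] at h
    exact h
  e₁_f₂ := gen2_e_f_ne .C qr qs (by decide)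
  e₂_f₂ := by
    have h := gen2_e_f_same .C qr qs 1
    simp [ri2] at h
    exact h
  e₂_f₁ := gen2_e_f_ne .C qr qs (by decide)
  ω₂_ω₁ := gen2_toral_comm .C qr qs trivial trivial
  ω₂_ω₁' := gen2_toral_comm .C qr qs trivial trivial
  ω₂'_ω₁' := gen2_toral_comm .C qr qs trivial trivial

theorem stmt19 :
    (e₁ * F₁₂ - F₁₂ * e₁ = -((qr + qs) • (ω₁ * f₂))) ∧
    (e₂ * F₁₂ - F₁₂ * e₂ = f₁ * ω₂') ∧
    (E₁₂ * f₁ - f₁ * E₁₂ = -((qr + qs) • (e₂ * ω₁'))) ∧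
    (E₁₂ * f₂ - f₂ * E₁₂ = ω₂ * e₁) ∧
    (E₁₂ * F₁₂ - F₁₂ * E₁₂ = (qr - qs)⁻¹ • (ω₁ * ω₂ - ω₁' * ω₂')) ∧
    (E₁₁₂ * F₁₁₂ - F₁₁₂ * E₁₁₂
      = ((qr + qs)^2 / (qr^2 - qs^2)) • (ω₁^2 * ω₂ - ω₁'^2 * ω₂')) := by
  have hr := qr_ne_zero
  have hs := qs_ne_zero
  have hd := qr_sub_qs_ne_zero
  have ha := qr_add_qs_ne_zero
  have h := typeCRelations_UC
  exact ⟨h.e₁_F₁₂ hr hs hd, h.e₂_F₁₂ hd ha, h.E₁₂_f₁ hd, h.E₁₂_f₂ hr hs hd ha,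
    h.E₁₂_F₁₂ hr hs hd ha, h.E₁₁₂_F₁₁₂ hr hs hd ha⟩

end Stmt19

end
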